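/- Let f be a holomorphic function with an isolated singular point at a point of an n-dimensional complex manifold with local coordinates x_1, …, x_n. Then for general t_1, …, t_n ∈ ℂ with sufficiently small absolute values, all singular points of the hypersurface {f + Σ_i t_i x_i = 0} (near the given point) are ordinary double points. -/

import Mathlib

/-!
**Statement 14** (the deformation fact used in (3.2) of M. Saito, "Direct image
of logarithmic complexes and infinitesimal invariants of cycles").

Let `f` be a holomorphic function with an isolated singular point at a point `a`
of an `n`-dimensional complex manifold with local coordinates `x_1, …, x_n`
(modelled here by an open set of `ℂ^n`): `f` and its partial derivatives have an
isolated common zero at `a`.  Then for general `t = (t_1, …, t_n) ∈ ℂ^n` with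
sufficiently small absolute values — i.e. for `t` in a subset of a small ball
around `0` which is open and dense in that ball — all singular points near `a`
of the hypersurface `{f + Σ_i t_i x_i = 0}` are ordinary double points, i.e.
points where `f + Σ_i t_i x_i` vanishes together with its first derivatives and
the Hessian is nondegenerate.
-/

open Metric

/-- The identification of `ℂ^n` with its dual for which `t` corresponds to `-Σ_i t_i x_i`. -/
noncomputable def negDualEquiv (n : ℕ) : ((Fin n → ℂ) →L[ℂ] ℂ) ≃L[ℂ] (Fin n → ℂ) :=
  ((LinearMap.toContinuousLinearMap.symm.trans
    (LinearEquiv.piRing ℂ ℂ (Fin n) ℂ)).trans (LinearEquiv.neg ℂ)).toContinuousLinearEquiv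

lemma negDualEquiv_apply (n : ℕ) (φ : (Fin n → ℂ) →L[ℂ] ℂ) (i : Fin n) :
    negDualEquiv n φ i = -φ (Pi.single i 1) := by
  simp [negDualEquiv]

lemma negDualEquiv_sum_proj (n : ℕ) (t : Fin n → ℂ) :
    negDualEquiv n (∑ i, t i • ContinuousLinearMap.proj (R := ℂ) (φ := fun _ : Fin n => ℂ) i) =
      -t := by
  ext i
  simp [negDualEquiv_apply, Pi.single_apply]

lemma fderiv_add_sum_mul {n : ℕ} {f : (Fin n → ℂ) → ℂ} {z : Fin n → ℂ}
    (hf : DifferentiableAt ℂ f z) (t : Fin n → ℂ) :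
    fderiv ℂ (fun w => f w + ∑ i, t i * w i) z =
      fderiv ℂ f z +
        ∑ i, t i • ContinuousLinearMap.proj (R := ℂ) (φ := fun _ : Fin n => ℂ) i := by
  refine (hf.hasFDerivAt.add (HasFDerivAt.fun_sum fun i _ => ?_)).fderiv
  exact (ContinuousLinearMap.proj (R := ℂ) (φ := fun _ : Fin n => ℂ) i).hasFDerivAt.const_mul (t i)

/-- Sard's theorem on a compact set: the critical values of an equidimensional `C^1` map form a
closed set with dense complement. -/
lemma isClosed_dense_compl_image_det_fderiv_eq_zero {E : Type*} [NormedAddCommGroup E]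
    [NormedSpace ℝ E] [FiniteDimensional ℝ E] {g : E → E} {K : Set E} (hK : IsCompact K)
    (hg : ∀ z ∈ K, DifferentiableAt ℝ g z) (hg' : ContinuousOn (fderiv ℝ g) K) :
    IsClosed (g '' {z ∈ K | (fderiv ℝ g z).det = 0}) ∧
      Dense (g '' {z ∈ K | (fderiv ℝ g z).det = 0})ᶜ := by
  borelize E
  constructor
  · have hdet : ContinuousOn (fun z => (fderiv ℝ g z).det) K :=
      ContinuousLinearMap.continuous_det.comp_continuousOn hg'
    have hclosed : IsClosed {z ∈ K | (fderiv ℝ g z).det = 0} :=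
      hdet.preimage_isClosed_of_isClosed hK.isClosed isClosed_singleton
    refine ((hK.of_isClosed_subset hclosed fun z hz => hz.1).image_of_continuousOn ?_).isClosed
    exact fun z hz => (hg z hz.1).continuousAt.continuousWithinAt
  · rw [← interior_eq_empty_iff_dense_compl]
    exact MeasureTheory.Measure.interior_eq_empty_of_null
      (MeasureTheory.addHaar_image_eq_zero_of_det_fderivWithin_eq_zero MeasureTheory.Measure.addHaar
        (fun z hz => (hg z hz.1).hasFDerivAt.hasFDerivWithinAt) fun z hz => hz.2)

theorem isolated_singularity_deforms_to_ordinary_double_points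
    (n : ℕ) (U : Set (Fin n → ℂ)) (hU : IsOpen U)
    (a : Fin n → ℂ) (ha : a ∈ U)
    (f : (Fin n → ℂ) → ℂ) (hf : AnalyticOnNhd ℂ f U)
    -- `a` is an isolated singular point of `{f = 0}` : `f` and its first
    -- derivatives vanish at `a`, and `a` is an isolated critical point of `f`
    (hf0 : f a = 0) (hdf0 : fderiv ℂ f a = 0)
    (hiso : ∀ᶠ z in nhdsWithin a {a}ᶜ, fderiv ℂ f z ≠ 0) :
    ∃ ρ > (0 : ℝ), ball a ρ ⊆ U ∧
      ∀ ε > (0 : ℝ), ∃ G : Set (Fin n → ℂ),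
        -- `G` : the set of "general" parameters `t` of absolute value `< ε`
        IsOpen G ∧ G ⊆ ball 0 ε ∧ ball (0 : Fin n → ℂ) ε ⊆ closure G ∧
        ∀ t ∈ G, ∀ z ∈ ball a ρ,
          -- if `z` is a singular point of the hypersurface `{f + Σ_i t_i x_i = 0}` ...
          (f z + ∑ i, t i * z i = 0 ∧
            fderiv ℂ (fun w => f w + ∑ i, t i * w i) z = 0) →
          -- ... then it is an ordinary double point: the Hessian of
          -- `f + Σ_i t_i x_i` at `z` is nondegenerate
          Function.Bijective
            ⇑(fderiv ℂ (fun w => fderiv ℂ (fun v => f v + ∑ i, t i * v i) w) z) := by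
  obtain ⟨ρ, hρ, hρU⟩ := Metric.nhds_basis_closedBall.mem_iff.1 (hU.mem_nhds ha)
  refine ⟨ρ, hρ, ball_subset_closedBall.trans hρU, fun ε _ => ?_⟩
  set g : (Fin n → ℂ) → (Fin n → ℂ) := fun z => negDualEquiv n (fderiv ℂ f z)
  have hgan : AnalyticOnNhd ℂ g U := fun z hz =>
    ((negDualEquiv n).toContinuousLinearMap.analyticAt _).comp (hf.fderiv z hz)
  have hganR : AnalyticOnNhd ℝ g U := fun z hz => (hgan z hz).restrictScalars
  obtain ⟨hclosed, hdense⟩ := isClosed_dense_compl_image_det_fderiv_eq_zero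
    (isCompact_closedBall a ρ) (fun z hz => (hganR z (hρU hz)).differentiableAt)
    (hganR.fderiv.continuousOn.mono hρU)
  refine ⟨ball 0 ε ∩ (g '' {z ∈ closedBall a ρ | (fderiv ℝ g z).det = 0})ᶜ,
    isOpen_ball.inter hclosed.isOpen_compl, Set.inter_subset_left,
    hdense.open_subset_closure_inter isOpen_ball, ?_⟩
  rintro t ⟨-, ht⟩ z hz ⟨-, hcrit⟩
  have hzU : z ∈ U := hρU (ball_subset_closedBall hz)
  rw [fderiv_add_sum_mul (hf z hzU).differentiableAt] at hcrit
  have hgz : g z = t := by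
    have h := congrArg (negDualEquiv n) hcrit
    rwa [map_add, negDualEquiv_sum_proj, map_zero, add_neg_eq_zero] at h
  have hdet : (fderiv ℝ g z).det ≠ 0 := fun h =>
    ht ⟨z, ⟨ball_subset_closedBall hz, h⟩, hgz⟩
  have hbij : Function.Bijective (fderiv ℝ g z) :=
    (LinearMap.equivOfDetNeZero (fderiv ℝ g z : (Fin n → ℂ) →ₗ[ℝ] (Fin n → ℂ)) hdet).bijective
  have hhess : fderiv ℂ (fun w => fderiv ℂ (fun v => f v + ∑ i, t i * v i) w) z =
      fderiv ℂ (fderiv ℂ f) z := by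
    rw [← fderiv_add_const (𝕜 := ℂ) (f := fderiv ℂ f)
      (∑ i, t i • ContinuousLinearMap.proj (R := ℂ) (φ := fun _ : Fin n => ℂ) i)]
    apply Filter.EventuallyEq.fderiv_eq
    filter_upwards [hU.mem_nhds hzU] with w hw
    exact fderiv_add_sum_mul (hf w hw).differentiableAt t
  have hgderiv : ⇑(fderiv ℝ g z) = negDualEquiv n ∘ fderiv ℂ (fderiv ℂ f) z := by
    rw [(hgan z hzU).differentiableAt.fderiv_restrictScalars ℝ,
      show g = negDualEquiv n ∘ fderiv ℂ f from rfl, (negDualEquiv n).comp_fderiv]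
    rfl
  rw [hhess]
  rwa [hgderiv, (negDualEquiv n).bijective.of_comp_iff'] at hbij
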